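/- Let 0 < α < 1. There exists a constant C > 0 depending only on α such that for every T₀ > 0, every λ > 0, every twice continuously differentiable f : [0,∞) → ℂ with support contained in (0, T₀), and every t ≥ 0, the function u(t) := ∫_0^t K_λ(t−τ) f(τ) dτ satisfies λ² |u(t)|² ≤ C T₀ ∫_0^{T₀} |f′(τ)|² dτ. -/

import Mathlib

/-- The Mittag–Leffler function `E_{a,b}(z) = ∑_{k=0}^∞ z^k / Γ(ka + b)`. -/
noncomputable def mittagLeffler (a b : ℝ) (z : ℂ) : ℂ :=
  ∑' k : ℕ, z ^ k / (Real.Gamma (k * a + b) : ℂ)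

/-- The kernel `K_λ(t) = -i t^{α-1} E_{α,α}(i λ t^α)`. -/
noncomputable def fracKernel (α lam t : ℝ) : ℂ :=
  -Complex.I * ((t ^ (α - 1) : ℝ) : ℂ) *
    mittagLeffler α α (Complex.I * (lam : ℂ) * ((t ^ α : ℝ) : ℂ))

/-- The convolution solution `u(t) = ∫_0^t K_λ(t-τ) f(τ) dτ`. -/
noncomputable def convSol (α lam : ℝ) (f : ℝ → ℂ) (t : ℝ) : ℂ :=
  ∫ τ in (0:ℝ)..t, fracKernel α lam (t - τ) * f τ

open Filter Topology

theorem Ring.succ_mul_multichoose_succ (s : ℝ) (n : ℕ) :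
    (n + 1) * Ring.multichoose s (n + 1) = (s + n) * Ring.multichoose s n := by
  have h1 := Ring.factorial_nsmul_multichoose_eq_ascPochhammer s (n + 1)
  have h0 := Ring.factorial_nsmul_multichoose_eq_ascPochhammer s n
  rw [Polynomial.ascPochhammer_smeval_eq_eval] at h0 h1
  rw [ascPochhammer_succ_eval, ← h0, Nat.factorial_succ] at h1
  simp only [nsmul_eq_mul] at h1
  push_cast at h1
  have : (n.factorial : ℝ) ≠ 0 := by positivity
  apply mul_left_cancel₀ this
  linarith

theorem Ring.multichoose_add (r s : ℝ) (n : ℕ) :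
    Ring.multichoose (r + s) n =
      ∑ ij ∈ Finset.HasAntidiagonal.antidiagonal n,
        Ring.multichoose r ij.1 * Ring.multichoose s ij.2 := by
  have key (x : ℝ) (k : ℕ) : Ring.multichoose x k = (-1) ^ k * Ring.choose (-x) k := by
    rw [Ring.choose_neg, ← Ring.multichoose_eq, Units.smul_def, zsmul_eq_mul]
    push_cast [Int.coe_negOnePow_natCast]
    rw [← mul_assoc, ← mul_pow]; simp
  rw [key, neg_add, Ring.add_choose_eq n (Commute.all _ _), Finset.mul_sum]
  refine Finset.sum_congr rfl fun ij hij => ?_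
  rw [key r, key s, ← Finset.HasAntidiagonal.mem_antidiagonal.1 hij, pow_add]
  ring

theorem Ring.multichoose_nonneg {s : ℝ} (hs : 0 ≤ s) (n : ℕ) : 0 ≤ Ring.multichoose s n := by
  induction n with
  | zero => simp
  | succ n ih =>
    have := Ring.succ_mul_multichoose_succ s n
    have h : 0 ≤ (n + 1 : ℝ) * Ring.multichoose s (n + 1) := this ▸ by positivity
    exact nonneg_of_mul_nonneg_right h (by positivity)

theorem Ring.multichoose_neg_succ_nonpos {s : ℝ} (h0 : 0 ≤ s) (h1 : s ≤ 1) (n : ℕ) :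
    Ring.multichoose (-s) (n + 1) ≤ 0 := by
  induction n with
  | zero => simpa
  | succ n ih =>
    have := Ring.succ_mul_multichoose_succ (-s) (n + 1)
    push_cast at this
    have h : (n + 1 + 1 : ℝ) * Ring.multichoose (-s) (n + 1 + 1) ≤ 0 :=
      this ▸ mul_nonpos_of_nonneg_of_nonpos (by linarith [n.cast_nonneg (α := ℝ)]) ih
    exact nonpos_of_mul_nonpos_right h (by positivity)

/-- Fractional discrete evolution with an imaginary eigenvalue is contractive. -/
theorem norm_le_one_of_multichoose_recurrence {α μ : ℝ} (h0 : 0 ≤ α) (h1 : α ≤ 1) {u : ℕ → ℂ}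
    (hu : ∀ n, ∑ ij ∈ Finset.HasAntidiagonal.antidiagonal n, ((Ring.multichoose (-α) ij.1 : ℝ) : ℂ) * u ij.2 =
      Ring.multichoose (1 - α) n + Complex.I * μ * u n) (n : ℕ) : ‖u n‖ ≤ 1 := by
  induction n using Nat.strong_induction_on with
  | _ n ih =>
  have hn := hu n
  have hs := Ring.multichoose_add (-α) 1 n
  rw [Finset.Nat.sum_antidiagonal_eq_sum_range_succ_mk, Finset.sum_range_succ'] at hn hs
  simp only [Ring.multichoose_zero_right, Ring.multichoose_one, mul_one, Nat.sub_zero,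
    Complex.ofReal_one, one_mul] at hn hs
  have e : (1 - Complex.I * μ) * u n = Ring.multichoose (1 - α) n -
      ∑ k ∈ Finset.range n, ((Ring.multichoose (-α) (k + 1) : ℝ) : ℂ) * u (n - (k + 1)) := by
    linear_combination hn
  have hb : ‖(1 - Complex.I * μ) * u n‖ ≤ 1 := by
    rw [e]
    refine (norm_sub_le _ _).trans ?_
    have h2 : ‖∑ k ∈ Finset.range n, ((Ring.multichoose (-α) (k + 1) : ℝ) : ℂ) * u (n - (k + 1))‖ ≤
        ∑ k ∈ Finset.range n, -Ring.multichoose (-α) (k + 1) := by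
      refine norm_sum_le_of_le _ fun k hk => ?_
      have hk' := Finset.mem_range.1 hk
      have hw := Ring.multichoose_neg_succ_nonpos h0 h1 k
      rw [norm_mul, Complex.norm_real, Real.norm_of_nonpos hw]
      exact mul_le_of_le_one_right (by linarith) (ih _ (by omega))
    rw [Complex.norm_real, Real.norm_of_nonneg (Ring.multichoose_nonneg (by linarith) n)]
    rw [Finset.sum_neg_distrib] at h2
    rw [neg_add_eq_sub] at hs
    linarith
  have hc : 1 ≤ ‖1 - Complex.I * μ‖ := by
    simpa using Complex.re_le_norm (1 - Complex.I * (μ : ℂ))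
  rw [norm_mul] at hb
  nlinarith [norm_nonneg (u n)]

theorem antitone_multichoose_div_rpow {x : ℝ} (hx : 0 ≤ x) {m n : ℕ} (hm : 1 ≤ m) (hmn : m ≤ n) :
    Ring.multichoose (x + 1) n / (n : ℝ) ^ x ≤ Ring.multichoose (x + 1) m / (m : ℝ) ^ x := by
  induction n, hmn using Nat.le_induction with
  | base => rfl
  | succ n hn ih =>
    refine le_trans ?_ ih
    have hn0 : (0 : ℝ) < n := by exact_mod_cast hm.trans hn
    have hr := Ring.succ_mul_multichoose_succ (x + 1) n
    have hM := Ring.multichoose_nonneg (by linarith : 0 ≤ x + 1) n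
    have key : (1 + x / (n + 1)) * (n : ℝ) ^ x ≤ (n + 1 : ℝ) ^ x := by
      have h1 : ((n + 1 : ℝ)) ^ x = ((n + 1) / n : ℝ) ^ x * (n : ℝ) ^ x := by
        rw [← Real.mul_rpow (by positivity) hn0.le]; congr 1; field_simp
      rw [h1]
      gcongr
      rw [Real.rpow_def_of_pos (by positivity)]
      have h2 := Real.one_sub_inv_le_log_of_pos (show 0 < (n + 1 : ℝ) / n by positivity)
      have h3 : 1 - ((n + 1 : ℝ) / n)⁻¹ = 1 / (n + 1) := by field_simp; ring
      rw [h3] at h2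
      have h4 := Real.add_one_le_exp (Real.log ((n + 1 : ℝ) / n) * x)
      have h5 : x / (n + 1) ≤ Real.log ((n + 1 : ℝ) / n) * x := by
        calc x / (n + 1) = 1 / (n + 1) * x := by ring
          _ ≤ _ := by gcongr
      linarith
    have e : Ring.multichoose (x + 1) (n + 1) =
        (1 + x / (n + 1)) * Ring.multichoose (x + 1) n := by
      field_simp; linear_combination hr
    push_cast
    rw [e, div_le_div_iff₀ (by positivity) (by positivity)]
    nlinarith

theorem tendsto_multichoose_div_rpow {x : ℝ} (hx : 0 ≤ x) :
    Tendsto (fun n : ℕ => Ring.multichoose (x + 1) n / (n : ℝ) ^ x) atTop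
      (𝓝 (1 / Real.Gamma (x + 1))) := by
  have hG : Real.Gamma (x + 1) ≠ 0 := (Real.Gamma_pos_of_pos (by linarith)).ne'
  have h1 : Tendsto (fun n : ℕ => (n : ℝ) / (n + (x + 1))) atTop (𝓝 1) :=
    tendsto_natCast_div_add_atTop (x + 1)
  refine (h1.div (Real.GammaSeq_tendsto_Gamma (x + 1)) hG).congr' ?_
  filter_upwards [eventually_ge_atTop 1] with n hn
  have hn0 : (0 : ℝ) < n := by exact_mod_cast hn
  have hp (n : ℕ) : (n.factorial : ℝ) * Ring.multichoose (x + 1) n =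
      ∏ j ∈ Finset.range n, (x + 1 + j) := by
    induction n with
    | zero => simp
    | succ n ih =>
      rw [Finset.prod_range_succ, ← ih, Nat.factorial_succ]
      push_cast
      linear_combination (n.factorial : ℝ) * Ring.succ_mul_multichoose_succ (x + 1) n
  simp only [Pi.div_apply, Real.GammaSeq]
  rw [Finset.prod_range_succ, ← hp, Real.rpow_add hn0, Real.rpow_one]
  have : (n.factorial : ℝ) ≠ 0 := by positivity
  field_simp
  ring

theorem multichoose_natCast_mul_add_one_le {α : ℝ} (h0 : 0 ≤ α) (h1 : α ≤ 1) (k n : ℕ) :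
    Ring.multichoose (k * α + 1) n ≤ ((k + 1 : ℕ) : ℝ) ^ n := by
  induction n with
  | zero => simp
  | succ n ih =>
    have hr := Ring.succ_mul_multichoose_succ (k * α + 1) n
    have hM := Ring.multichoose_nonneg (by positivity : 0 ≤ k * α + 1) n
    have hk : (k * α + 1 + n : ℝ) ≤ (n + 1) * (k + 1) := by
      have : (k : ℝ) * α ≤ k := mul_le_of_le_one_right (by positivity) h1
      nlinarith [mul_nonneg (n.cast_nonneg (α := ℝ)) (k.cast_nonneg (α := ℝ))]
    have h2 : (n + 1 : ℝ) * Ring.multichoose (k * α + 1) (n + 1) ≤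
        (n + 1) * ((k + 1 : ℕ) : ℝ) ^ (n + 1) := by
      rw [hr]
      push_cast at ih ⊢
      calc _ ≤ ((n + 1) * (k + 1) : ℝ) * (k + 1) ^ n := by gcongr
        _ = _ := by ring
    exact le_of_mul_le_mul_left h2 (by positivity)

theorem summable_mul_pow_mul_multichoose {α : ℝ} (h0 : 0 ≤ α) (h1 : α ≤ 1) {r : ℝ} (hr0 : 0 < r)
    (hr1 : r < 1) (n : ℕ) :
    Summable fun k : ℕ => (k + 1) * (r ^ k * Ring.multichoose (k * α + 1) n) := by
  have hg : Summable fun k : ℕ => (k : ℝ) ^ (n + 1) * r ^ k :=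
    summable_pow_mul_geometric_of_norm_lt_one (n + 1) (by rwa [Real.norm_of_nonneg hr0.le])
  have hs : Summable fun k : ℕ => ((k + 1 : ℕ) : ℝ) ^ (n + 1) * r ^ (k + 1) :=
    hg.comp_injective (add_left_injective 1)
  refine .of_nonneg_of_le (fun k => ?_) (fun k => ?_) (hs.mul_right r⁻¹)
  · have := Ring.multichoose_nonneg (by positivity : 0 ≤ k * α + 1) n
    positivity
  · calc _ ≤ (k + 1) * (r ^ k * ((k + 1 : ℕ) : ℝ) ^ n) := by
          gcongr
          exact multichoose_natCast_mul_add_one_le h0 h1 k n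
      _ = _ := by
          push_cast
          field_simp
          ring

theorem summable_pow_mul_multichoose {α : ℝ} (h0 : 0 ≤ α) (h1 : α ≤ 1) {r : ℝ} (hr0 : 0 < r)
    (hr1 : r < 1) (n : ℕ) :
    Summable fun k : ℕ => r ^ k * Ring.multichoose (k * α + 1) n := by
  refine .of_nonneg_of_le (fun k => ?_) (fun k => ?_)
    (summable_mul_pow_mul_multichoose h0 h1 hr0 hr1 n)
  · have := Ring.multichoose_nonneg (by positivity : 0 ≤ k * α + 1) n
    positivity
  · have := Ring.multichoose_nonneg (by positivity : 0 ≤ k * α + 1) n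
    exact le_mul_of_one_le_left (by positivity) (by linarith [k.cast_nonneg (α := ℝ)])

theorem norm_tsum_multichoose_le_one {α : ℝ} (h0 : 0 ≤ α) (h1 : α ≤ 1) {μ : ℝ} (hμ0 : 0 < μ)
    (hμ1 : μ < 1) (n : ℕ) :
    ‖∑' k : ℕ, (Complex.I * μ) ^ k * ((Ring.multichoose (k * α + 1) n : ℝ) : ℂ)‖ ≤ 1 := by
  have hs (n : ℕ) : Summable fun k : ℕ =>
      (Complex.I * μ) ^ k * ((Ring.multichoose (k * α + 1) n : ℝ) : ℂ) := by
    refine .of_norm ((summable_pow_mul_multichoose h0 h1 hμ0 hμ1 n).congr fun k => ?_)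
    rw [norm_mul, norm_pow, norm_mul, Complex.norm_I, one_mul, Complex.norm_real,
      Complex.norm_real, Real.norm_of_nonneg hμ0.le,
      Real.norm_of_nonneg (Ring.multichoose_nonneg (by positivity) n)]
  refine norm_le_one_of_multichoose_recurrence (μ := μ) h0 h1 (u := fun n =>
    ∑' k : ℕ, (Complex.I * μ) ^ k * ((Ring.multichoose (k * α + 1) n : ℝ) : ℂ)) (fun n => ?_) n
  have hv (k : ℕ) : ∑ ij ∈ Finset.HasAntidiagonal.antidiagonal n,
      ((Ring.multichoose (-α) ij.1 : ℝ) : ℂ) *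
        ((Complex.I * μ) ^ k * ((Ring.multichoose (k * α + 1) ij.2 : ℝ) : ℂ)) =
      (Complex.I * μ) ^ k * ((Ring.multichoose (-α + (k * α + 1)) n : ℝ) : ℂ) := by
    rw [Ring.multichoose_add]
    push_cast
    rw [Finset.mul_sum]
    exact Finset.sum_congr rfl fun _ _ => by ring
  have hv' := hasSum_sum fun ij (_ : ij ∈ Finset.HasAntidiagonal.antidiagonal n) =>
    (hs ij.2).hasSum.mul_left ((Ring.multichoose (-α) ij.1 : ℝ) : ℂ)
  simp only [hv] at hv'
  rw [← hv'.tsum_eq, hv'.summable.tsum_eq_zero_add, ← tsum_mul_left]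
  congr 1
  · rw [pow_zero, one_mul, Nat.cast_zero, zero_mul, zero_add, neg_add_eq_sub]
  · refine tsum_congr fun k => ?_
    rw [pow_succ', Nat.cast_succ, show -α + ((k + 1) * α + 1) = k * α + 1 by ring, mul_assoc]

theorem inv_Gamma_le_multichoose_div_rpow {x : ℝ} (hx : 0 ≤ x) {n : ℕ} (hn : 1 ≤ n) :
    1 / Real.Gamma (x + 1) ≤ Ring.multichoose (x + 1) n / (n : ℝ) ^ x :=
  le_of_tendsto (tendsto_multichoose_div_rpow hx) <| by
    filter_upwards [eventually_ge_atTop n] with m hm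
    exact antitone_multichoose_div_rpow hx hn hm

theorem eventually_lt_natCast_rpow {α : ℝ} (h0 : 0 < α) (R : ℝ) :
    ∀ᶠ n : ℕ in atTop, R < (n : ℝ) ^ α :=
  ((tendsto_rpow_atTop h0).comp tendsto_natCast_atTop_atTop).eventually_gt_atTop R

theorem pow_mul_multichoose_div_rpow (α y : ℝ) {n : ℕ} (k : ℕ) :
    y ^ k * (Ring.multichoose (k * α + 1) n / (n : ℝ) ^ (k * α)) =
      (y / (n : ℝ) ^ α) ^ k * Ring.multichoose (k * α + 1) n := by
  rw [mul_comm (k : ℝ) α, Real.rpow_mul_natCast n.cast_nonneg, div_pow]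
  ring

theorem summable_mul_pow_div_Gamma {α : ℝ} (h0 : 0 < α) (h1 : α ≤ 1) {R : ℝ} (hR : 0 < R) :
    Summable fun k : ℕ => (k + 1) * (R ^ k / Real.Gamma (k * α + 1)) := by
  obtain ⟨N, hN, hN1⟩ :=
    ((eventually_lt_natCast_rpow h0 R).and (eventually_ge_atTop 1)).exists
  have hN0 : (0 : ℝ) < (N : ℝ) ^ α := hR.trans hN
  refine .of_nonneg_of_le (fun k => ?_) (fun k => ?_)
    (summable_mul_pow_mul_multichoose h0.le h1 (div_pos hR hN0) ((div_lt_one hN0).2 hN) N)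
  · have := Real.Gamma_pos_of_pos (by positivity : 0 < k * α + 1)
    positivity
  · rw [← pow_mul_multichoose_div_rpow, div_eq_mul_one_div]
    have := inv_Gamma_le_multichoose_div_rpow (by positivity : 0 ≤ k * α) hN1
    gcongr

theorem norm_mittagLeffler_I_mul_le_one {α : ℝ} (h0 : 0 < α) (h1 : α ≤ 1) {y : ℝ} (hy : 0 ≤ y) :
    ‖mittagLeffler α 1 (Complex.I * y)‖ ≤ 1 := by
  obtain rfl | hy := hy.eq_or_lt
  · rw [mittagLeffler, tsum_eq_single 0 fun k hk => by simp [hk]]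
    simp
  obtain ⟨N, hN, hN1⟩ :=
    ((eventually_lt_natCast_rpow h0 y).and (eventually_ge_atTop 1)).exists
  have hN0 : (0 : ℝ) < (N : ℝ) ^ α := hy.trans hN
  have ht : Tendsto (fun n : ℕ => ∑' k : ℕ, (Complex.I * y) ^ k *
      ((Ring.multichoose (k * α + 1) n / (n : ℝ) ^ (k * α) : ℝ) : ℂ)) atTop
      (𝓝 (mittagLeffler α 1 (Complex.I * y))) := by
    refine tendsto_tsum_of_dominated_convergence
      (summable_pow_mul_multichoose h0.le h1 (div_pos hy hN0) ((div_lt_one hN0).2 hN) N)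
      (fun k => ?_) ?_
    · have := (Complex.continuous_ofReal.tendsto _).comp
        (tendsto_multichoose_div_rpow (by positivity : 0 ≤ k * α))
      convert this.const_mul ((Complex.I * y) ^ k) using 2
      · simp
      · rw [Complex.ofReal_div, Complex.ofReal_one, mul_one_div]
    · filter_upwards [eventually_ge_atTop N] with n hn k
      have hM := Ring.multichoose_nonneg (by positivity : 0 ≤ k * α + 1) n
      rw [norm_mul, norm_pow, norm_mul, Complex.norm_I, one_mul, Complex.norm_real,
        Complex.norm_real, Real.norm_of_nonneg hy.le, Real.norm_of_nonneg (by positivity),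
        ← pow_mul_multichoose_div_rpow]
      exact mul_le_mul_of_nonneg_left
        (antitone_multichoose_div_rpow (by positivity : 0 ≤ k * α) hN1 hn) (by positivity)
  refine le_of_tendsto ht.norm ?_
  filter_upwards [eventually_lt_natCast_rpow h0 y] with n hn
  have hn0 : (0 : ℝ) < (n : ℝ) ^ α := hy.trans hn
  refine le_of_eq_of_le ?_
    (norm_tsum_multichoose_le_one h0.le h1 (div_pos hy hn0) ((div_lt_one hn0).2 hn) n)
  congr 1
  refine tsum_congr fun k => ?_
  have := congrArg (fun x : ℝ => (x : ℂ)) (pow_mul_multichoose_div_rpow α y (n := n) k)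
  push_cast at this ⊢
  rw [mul_pow, mul_pow, mul_assoc, this, mul_assoc]

theorem hasDerivAt_mittagLeffler {α : ℝ} (h0 : 0 < α) (h1 : α ≤ 1) (z : ℂ) :
    HasDerivAt (mittagLeffler α 1) (mittagLeffler α α z / α) z := by
  set R : ℝ := ‖z‖ + 1 with hRdef
  have hR : 0 < R := by positivity
  have hsum := summable_mul_pow_div_Gamma h0 h1 hR
  have hG (k : ℕ) : 0 < Real.Gamma (k * α + 1) := Real.Gamma_pos_of_pos (by positivity)
  have hz : z ∈ Metric.ball (0 : ℂ) R := by simp [hRdef]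
  have hbound (k : ℕ) (w : ℂ) (hw : w ∈ Metric.ball 0 R) :
      ‖(k * w ^ (k - 1)) / (Real.Gamma (k * α + 1) : ℂ)‖ ≤
        (k + 1) * (R ^ k / Real.Gamma (k * α + 1)) * R⁻¹ := by
    rw [norm_div, norm_mul, norm_pow, Complex.norm_natCast, Complex.norm_real,
      Real.norm_of_nonneg (hG k).le]
    have hw' : ‖w‖ ≤ R := by simpa using (Metric.mem_ball.1 hw).le
    have hGk := hG k
    cases k with
    | zero => simp; positivity
    | succ k =>
      rw [Nat.add_sub_cancel]
      calc _ ≤ (((k + 1 : ℕ) : ℝ) + 1) * R ^ k / Real.Gamma ((k + 1 : ℕ) * α + 1) := by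
            gcongr
            linarith
        _ = _ := by rw [pow_succ]; field_simp
  have hd : HasDerivAt (mittagLeffler α 1)
      (∑' k : ℕ, (k * z ^ (k - 1)) / (Real.Gamma (k * α + 1) : ℂ)) z := by
    refine hasDerivAt_tsum_of_isPreconnected (hsum.mul_right R⁻¹)
      Metric.isOpen_ball (convex_ball (0 : ℂ) R).isPreconnected
      (fun k w _ => (hasDerivAt_pow k w).div_const _) hbound
      (Metric.mem_ball_self hR) (summable_of_hasFiniteSupport ?_) hz
    refine (Set.finite_singleton 0).subset fun k hk => ?_
    by_contra h
    exact hk (by simp [show k ≠ 0 from h])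
  convert hd using 1
  have hsd : Summable fun k : ℕ => (k * z ^ (k - 1)) / (Real.Gamma (k * α + 1) : ℂ) :=
    .of_norm_bounded (hsum.mul_right R⁻¹) fun k => hbound k z hz
  rw [hsd.tsum_eq_zero_add, mittagLeffler, ← tsum_div_const]
  simp only [Nat.cast_zero, zero_mul, zero_div, zero_add]
  refine tsum_congr fun k => ?_
  have hp : (0 : ℝ) < (k + 1) * α := by positivity
  have hGa : Real.Gamma ((k + 1) * α) ≠ 0 := (Real.Gamma_pos_of_pos hp).ne'
  rw [show k * α + α = (k + 1) * α by ring, Nat.cast_succ, Nat.cast_succ,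
    Real.Gamma_add_one hp.ne', Nat.add_sub_cancel]
  have h2 : (k : ℂ) + 1 ≠ 0 := by exact_mod_cast k.succ_ne_zero
  have h3 : (α : ℂ) ≠ 0 := by exact_mod_cast h0.ne'
  have h4 : (Real.Gamma ((k + 1) * α) : ℂ) ≠ 0 := by exact_mod_cast hGa
  push_cast
  field_simp

theorem continuous_mittagLeffler {α : ℝ} (h0 : 0 < α) (h1 : α ≤ 1) :
    Continuous (mittagLeffler α α) := by
  have hd : Differentiable ℂ (mittagLeffler α 1) := fun z =>
    (hasDerivAt_mittagLeffler h0 h1 z).differentiableAt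
  have hα : (α : ℂ) ≠ 0 := by exact_mod_cast h0.ne'
  have hc : Continuous (deriv (mittagLeffler α 1)) := hd.contDiff.continuous_deriv le_rfl
  refine (hc.mul_const (α : ℂ)).congr fun z => ?_
  rw [(hasDerivAt_mittagLeffler h0 h1 z).deriv, div_mul_cancel₀ _ hα]

theorem hasDerivAt_mittagLeffler_rpow {α : ℝ} (h0 : 0 < α) (h1 : α ≤ 1) (lam : ℝ) {s : ℝ}
    (hs : 0 < s) :
    HasDerivAt (fun s : ℝ => mittagLeffler α 1 (Complex.I * lam * ((s ^ α : ℝ) : ℂ)))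
      (-lam * fracKernel α lam s) s := by
  have hα : (α : ℂ) ≠ 0 := by exact_mod_cast h0.ne'
  have hr := ((Real.hasDerivAt_rpow_const (x := s) (p := α) (.inl hs.ne')).ofReal_comp).const_mul
    (Complex.I * lam : ℂ)
  refine ((hasDerivAt_mittagLeffler h0 h1 _).comp s hr).congr_deriv ?_
  rw [fracKernel]
  push_cast
  field_simp

theorem intervalIntegrable_fracKernel_mul {α : ℝ} (h0 : 0 < α) (h1 : α ≤ 1) (lam t : ℝ)
    {f : ℝ → ℂ} (hf : Continuous f) :
    IntervalIntegrable (fun τ => fracKernel α lam (t - τ) * f τ) MeasureTheory.volume 0 t := by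
  have hr : IntervalIntegrable (fun s : ℝ => s ^ (α - 1)) MeasureTheory.volume 0 t :=
    intervalIntegral.intervalIntegrable_rpow' (by linarith)
  have hr' : IntervalIntegrable (fun τ : ℝ => (((t - τ) ^ (α - 1) : ℝ) : ℂ))
      MeasureTheory.volume 0 t := by
    have := (hr.comp_sub_left t).symm
    simp only [sub_zero, sub_self] at this
    exact ⟨this.1.ofReal, this.2.ofReal⟩
  have hc : Continuous fun τ : ℝ => -Complex.I *
      (mittagLeffler α α (Complex.I * lam * (((t - τ) ^ α : ℝ) : ℂ)) * f τ) := by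
    have hp : Continuous fun τ : ℝ => (t - τ) ^ α :=
      (Real.continuous_rpow_const h0.le).comp (by fun_prop)
    have := (continuous_mittagLeffler h0 h1).comp
      (continuous_const.mul (Complex.continuous_ofReal.comp hp) :
        Continuous fun τ : ℝ => Complex.I * lam * (((t - τ) ^ α : ℝ) : ℂ))
    exact continuous_const.mul (this.mul hf)
  refine (hr'.mul_continuousOn hc.continuousOn).congr fun τ _ => ?_
  simp only [fracKernel]
  ring

theorem mul_convSol_eq {α : ℝ} (h0 : 0 < α) (h1 : α ≤ 1) (lam : ℝ) {f : ℝ → ℂ}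
    (hf : ContDiff ℝ 1 f) (hf0 : f 0 = 0) {t : ℝ} (ht : 0 ≤ t) :
    lam * convSol α lam f t = ∫ τ in (0 : ℝ)..t,
      (1 - mittagLeffler α 1 (Complex.I * lam * (((t - τ) ^ α : ℝ) : ℂ))) * deriv f τ := by
  set v : ℝ → ℂ := fun s => mittagLeffler α 1 (Complex.I * lam * ((s ^ α : ℝ) : ℂ)) with hv
  have hvc : Continuous v := by
    have hd : Differentiable ℂ (mittagLeffler α 1) := fun z =>
      (hasDerivAt_mittagLeffler h0 h1 z).differentiableAt
    exact hd.continuous.comp (continuous_const.mul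
      (Complex.continuous_ofReal.comp (Real.continuous_rpow_const h0.le)))
  have hv0 : v 0 = 1 := by
    simp only [hv, Real.zero_rpow h0.ne', Complex.ofReal_zero, mul_zero]
    rw [mittagLeffler, tsum_eq_single 0 fun k hk => by simp [hk]]
    simp
  have hvt : Continuous fun τ => v (t - τ) := hvc.comp (by fun_prop)
  have hf' : Continuous (deriv f) := hf.continuous_deriv le_rfl
  have hfd (τ : ℝ) : HasDerivAt f (deriv f τ) τ :=
    (hf.differentiable one_ne_zero τ).hasDerivAt
  have hK := (intervalIntegrable_fracKernel_mul h0 h1 lam t hf.continuous).const_mul (lam : ℂ)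
  have hV : IntervalIntegrable (fun τ => v (t - τ) * deriv f τ) MeasureTheory.volume 0 t :=
    (hvt.mul hf').intervalIntegrable _ _
  have hF : IntervalIntegrable (deriv f) MeasureTheory.volume 0 t := hf'.intervalIntegrable _ _
  have h := intervalIntegral.integral_eq_sub_of_hasDerivAt_of_le ht
    (hvt.mul hf.continuous).continuousOn (fun τ hτ => by
      have h2 : HasDerivAt (fun τ => v (t - τ)) (lam * fracKernel α lam (t - τ)) τ := by
        refine ((hasDerivAt_mittagLeffler_rpow h0 h1 lam
          (sub_pos.2 hτ.2)).scomp τ ((hasDerivAt_id τ).const_sub t)).congr_deriv ?_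
        simp
      exact ((h2.mul (hfd τ)).congr_deriv (by ring :
        _ = lam * (fracKernel α lam (t - τ) * f τ) + v (t - τ) * deriv f τ)))
    (hK.add hV)
  have h' := intervalIntegral.integral_eq_sub_of_hasDerivAt (fun τ _ => hfd τ) hF
  simp only [Pi.mul_apply, sub_self, hv0, hf0, one_mul, mul_zero, sub_zero] at h h'
  rw [intervalIntegral.integral_add hK hV, intervalIntegral.integral_const_mul] at h
  simp only [sub_mul, one_mul]
  rw [intervalIntegral.integral_sub hF hV, h', convSol]
  linear_combination h

theorem sq_intervalIntegral_le {g : ℝ → ℝ} (hg : Continuous g) {T : ℝ} (hT : 0 < T) :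
    (∫ τ in (0 : ℝ)..T, g τ) ^ 2 ≤ T * ∫ τ in (0 : ℝ)..T, g τ ^ 2 := by
  set m := (∫ τ in (0 : ℝ)..T, g τ) / T with hm
  have h : 0 ≤ ∫ τ in (0 : ℝ)..T, (g τ - m) ^ 2 :=
    intervalIntegral.integral_nonneg hT.le fun _ _ => sq_nonneg _
  have e (τ : ℝ) : (g τ - m) ^ 2 = g τ ^ 2 - 2 * m * g τ + m ^ 2 := by ring
  simp only [e] at h
  rw [intervalIntegral.integral_add (Continuous.intervalIntegrable (by fun_prop) _ _)
    (Continuous.intervalIntegrable (by fun_prop) _ _),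
    intervalIntegral.integral_sub (Continuous.intervalIntegrable (by fun_prop) _ _)
    (Continuous.intervalIntegrable (by fun_prop) _ _),
    intervalIntegral.integral_const_mul, intervalIntegral.integral_const] at h
  have hi : ∫ τ in (0 : ℝ)..T, g τ = m * T := by rw [hm]; field_simp
  rw [hi] at h ⊢
  simp only [sub_zero, smul_eq_mul] at h
  nlinarith

theorem intervalIntegral_le_of_eqOn_zero {g : ℝ → ℝ} (hg : Continuous g) (hg0 : ∀ τ, 0 ≤ g τ)
    {T t : ℝ} (ht : 0 ≤ t) (h : ∀ τ, T ≤ τ → g τ = 0) :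
    ∫ τ in (0 : ℝ)..t, g τ ≤ ∫ τ in (0 : ℝ)..T, g τ := by
  have hi (a b : ℝ) : IntervalIntegrable g MeasureTheory.volume a b := hg.intervalIntegrable a b
  rcases le_total t T with htT | hTt
  · exact intervalIntegral.integral_mono_interval le_rfl ht htT (MeasureTheory.ae_of_all _ hg0) (hi _ _)
  · rw [← intervalIntegral.integral_add_adjacent_intervals (hi 0 T) (hi T t),
      intervalIntegral.integral_congr (g := fun _ => 0) (a := T) fun τ hτ =>
        h τ (by rw [Set.uIcc_of_le hTt] at hτ; exact hτ.1)]
    simp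

theorem norm_mul_convSol_le {α : ℝ} (h0 : 0 < α) (h1 : α ≤ 1) {lam : ℝ} (hlam : 0 ≤ lam)
    {f : ℝ → ℂ} (hf : ContDiff ℝ 1 f) (hf0 : f 0 = 0) {t : ℝ} (ht : 0 ≤ t) :
    lam * ‖convSol α lam f t‖ ≤ 2 * ∫ τ in (0 : ℝ)..t, ‖deriv f τ‖ := by
  have e : lam * ‖convSol α lam f t‖ = ‖(lam : ℂ) * convSol α lam f t‖ := by
    rw [norm_mul, Complex.norm_real, Real.norm_of_nonneg hlam]
  rw [e, mul_convSol_eq h0 h1 lam hf hf0 ht, ← intervalIntegral.integral_const_mul]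
  refine intervalIntegral.norm_integral_le_of_norm_le ht (MeasureTheory.ae_of_all _ fun τ hτ => ?_)
    (((hf.continuous_deriv le_rfl).norm.const_mul 2).intervalIntegrable _ _)
  have hE := norm_mittagLeffler_I_mul_le_one h0 h1
    (mul_nonneg hlam (Real.rpow_nonneg (sub_nonneg.2 hτ.2) α))
  rw [Complex.ofReal_mul, ← mul_assoc] at hE
  rw [norm_mul]
  gcongr
  calc _ ≤ ‖(1 : ℂ)‖ + _ := norm_sub_le _ _
    _ ≤ 2 := by rw [norm_one]; linarith

/-- For `0 < α < 1` there is a constant `C > 0` depending only on `α` such that for every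
`T₀ > 0`, `λ > 0`, every `C²` function `f` supported in `(0, T₀)` and every `t ≥ 0`,
the solution `u(t) = ∫_0^t K_λ(t-τ) f(τ) dτ` satisfies
`λ² |u(t)|² ≤ C T₀ ∫_0^{T₀} |f'(τ)|² dτ`. -/
theorem convSol_energy_estimate (α : ℝ) (h0 : 0 < α) (h1 : α < 1) :
    ∃ C > 0, ∀ T₀ : ℝ, 0 < T₀ → ∀ lam : ℝ, 0 < lam → ∀ f : ℝ → ℂ,
      ContDiff ℝ 2 f → tsupport f ⊆ Set.Ioo 0 T₀ → ∀ t : ℝ, 0 ≤ t →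
        lam ^ 2 * ‖convSol α lam f t‖ ^ 2 ≤
          C * T₀ * ∫ τ in (0:ℝ)..T₀, ‖deriv f τ‖ ^ 2 := by
  refine ⟨4, by norm_num, fun T₀ hT lam hlam f hf hsupp t ht => ?_⟩
  have hf1 : ContDiff ℝ 1 f := hf.of_le one_le_two
  have hf0 : f 0 = 0 := image_eq_zero_of_notMem_tsupport fun h => (hsupp h).1.false
  have hf' : Continuous fun τ => ‖deriv f τ‖ := (hf1.continuous_deriv le_rfl).norm
  have hz (τ : ℝ) (hτ : T₀ ≤ τ) : ‖deriv f τ‖ = 0 := by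
    rw [norm_eq_zero]
    by_contra h
    exact (hsupp (support_deriv_subset h)).2.not_ge hτ
  have hb := (norm_mul_convSol_le h0 h1.le hlam.le hf1 hf0 ht).trans
    (mul_le_mul_of_nonneg_left (intervalIntegral_le_of_eqOn_zero hf' (fun _ => norm_nonneg _)
      ht hz) zero_le_two)
  calc lam ^ 2 * ‖convSol α lam f t‖ ^ 2 = (lam * ‖convSol α lam f t‖) ^ 2 := by ring
    _ ≤ (2 * ∫ τ in (0 : ℝ)..T₀, ‖deriv f τ‖) ^ 2 := by gcongr
    _ = 4 * (∫ τ in (0 : ℝ)..T₀, ‖deriv f τ‖) ^ 2 := by ring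
    _ ≤ 4 * (T₀ * ∫ τ in (0 : ℝ)..T₀, ‖deriv f τ‖ ^ 2) := by
        gcongr
        exact sq_intervalIntegral_le hf' hT
    _ = _ := by ring
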